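/- arXiv:2501.06328 — 5 statements merged into one kernel-verified Lean document; each statement's English description precedes it below -/
import Mathlib

section
/- Let M be a symmetric positive-definite real 2×2 matrix and let p₀, p₁, p₂ ∈ ℝ² be the vertices of a triangle each of whose edges has unit M-length, i.e., (pᵢ−pⱼ)ᵀM(pᵢ−pⱼ) = 1 for all i ≠ j. Then the M-area of the triangle equals the Euclidean area of the unit equilateral triangle: √(det M) · |det(p₁−p₀ , p₂−p₀)| / 2 = √3/4. -/
open Matrix

/-- The Gram determinant of two plane vectors with respect to a symmetric bilinear form `M` is
`det M` times the square of the determinant of the vectors. -/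
theorem det_mul_cross_sq_eq_gram {R : Type*} [CommRing R] {M : Matrix (Fin 2) (Fin 2) R}
    (hM : M.IsSymm) (u v : Fin 2 → R) :
    M.det * (u 0 * v 1 - u 1 * v 0) ^ 2 =
      (u ⬝ᵥ (M *ᵥ u)) * (v ⬝ᵥ (M *ᵥ v)) - (u ⬝ᵥ (M *ᵥ v)) ^ 2 := by
  have h : M 1 0 = M 0 1 := hM.apply 0 1
  simp only [det_fin_two, dotProduct, mulVec, Fin.sum_univ_two, h]
  ring

/-- The polarization identity for a symmetric bilinear form on the plane. -/
theorem dotProduct_mulVec_sub_self {R : Type*} [CommRing R] {M : Matrix (Fin 2) (Fin 2) R}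
    (hM : M.IsSymm) (u v : Fin 2 → R) :
    (v - u) ⬝ᵥ (M *ᵥ (v - u)) =
      u ⬝ᵥ (M *ᵥ u) + v ⬝ᵥ (M *ᵥ v) - 2 * (u ⬝ᵥ (M *ᵥ v)) := by
  have h : M 1 0 = M 0 1 := hM.apply 0 1
  simp only [dotProduct, mulVec, Fin.sum_univ_two, Pi.sub_apply, h]
  ring

/-- A triangle in ℝ² all of whose edges have unit length with respect to a
symmetric positive-definite metric `M` has `M`-area `√3/4`, the Euclidean area of the
unit equilateral triangle: `√(det M) · |det(p₁−p₀, p₂−p₀)| / 2 = √3/4`. -/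
theorem stmt_2 (M : Matrix (Fin 2) (Fin 2) ℝ) (hM : M.PosDef)
    (p₀ p₁ p₂ : Fin 2 → ℝ)
    (h01 : (p₁ - p₀) ⬝ᵥ (M *ᵥ (p₁ - p₀)) = 1)
    (h02 : (p₂ - p₀) ⬝ᵥ (M *ᵥ (p₂ - p₀)) = 1)
    (h12 : (p₂ - p₁) ⬝ᵥ (M *ᵥ (p₂ - p₁)) = 1) :
    Real.sqrt M.det *
        |(p₁ - p₀) 0 * (p₂ - p₀) 1 - (p₁ - p₀) 1 * (p₂ - p₀) 0| / 2 =
      Real.sqrt 3 / 4 := by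
  have hsymm : M.IsSymm := by
    simpa [IsHermitian, IsSymm, conjTranspose_eq_transpose_of_trivial] using hM.isHermitian
  have hpolar := dotProduct_mulVec_sub_self hsymm (p₁ - p₀) (p₂ - p₀)
  rw [sub_sub_sub_cancel_right, h01, h02, h12] at hpolar
  have hinner : (p₁ - p₀) ⬝ᵥ (M *ᵥ (p₂ - p₀)) = 1 / 2 := by linarith
  have hgram := det_mul_cross_sq_eq_gram hsymm (p₁ - p₀) (p₂ - p₀)
  rw [h01, h02, hinner] at hgram
  rw [← Real.sqrt_sq_eq_abs, ← Real.sqrt_mul hM.det_pos.le, hgram,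
    show (1 * 1 - (1 / 2) ^ 2 : ℝ) = 3 / 2 ^ 2 by norm_num,
    Real.sqrt_div' _ (by positivity), Real.sqrt_sq (by norm_num)]
  ring
end

section
/- Let w₀,…,w_n ∈ ℝⁿ (n ≥ 1) be n+1 points with pairwise Euclidean distance 1. Then the sum of the outer products of the edge vectors equals ((n+1)/2) times the identity matrix: Σ_{0 ≤ i < j ≤ n} (wᵢ − wⱼ)(wᵢ − wⱼ)ᵀ = ((n+1)/2) · Iₙ. -/
open Matrix

theorem two_nsmul_sum_sum_filter_lt {ι M : Type*} [Fintype ι] [LinearOrder ι] [AddCommMonoid M]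
    (f : ι → ι → M) (hsymm : ∀ i j, f i j = f j i) (hdiag : ∀ i, f i i = 0) :
    2 • ∑ i, ∑ j ∈ Finset.univ.filter (fun j => i < j), f i j = ∑ i, ∑ j, f i j := by
  have hswap : ∑ i, ∑ j, (if i < j then f i j else 0) = ∑ i, ∑ j, if j < i then f i j else 0 := by
    rw [Finset.sum_comm]
    simp only [hsymm]
  simp only [Finset.sum_filter]
  rw [two_nsmul]
  nth_rewrite 2 [hswap]
  simp only [← Finset.sum_add_distrib]
  refine Finset.sum_congr rfl fun i _ => Finset.sum_congr rfl fun j _ => ?_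
  rcases lt_trichotomy i j with h | rfl | h
  · simp [h, h.not_gt]
  · simp [hdiag]
  · simp [h, h.not_gt]

theorem sum_sum_sub_mul_sub {ι R : Type*} [Fintype ι] [CommRing R] (x y : ι → R) :
    ∑ i, ∑ j, (x i - x j) * (y i - y j) =
      2 * (Fintype.card ι * ∑ i, x i * y i - (∑ i, x i) * ∑ i, y i) := by
  have h : ∀ i j, (x i - x j) * (y i - y j) = x i * y i + x j * y j - x i * y j - x j * y i :=
    fun i j => by ring
  simp only [h, Finset.sum_sub_distrib, Finset.sum_add_distrib, Finset.sum_const,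
    Finset.card_univ, nsmul_eq_mul, ← Finset.mul_sum, ← Finset.sum_mul]
  ring

/-- The Gram matrix of the edges of a unit simplex issuing from its initial vertex. -/
theorem gram_edges_of_unit_simplex {m n : ℕ} (w : Fin (n + 1) → Fin m → ℝ)
    (hw : ∀ i j, i ≠ j → (w i - w j) ⬝ᵥ (w i - w j) = 1) :
    (of fun k : Fin n => w k.succ - w 0) * (of fun k : Fin n => w k.succ - w 0)ᵀ =
      (1 / 2 : ℝ) • (1 + of fun _ _ => 1) := by
  ext i j
  have hnorm : ∀ k : Fin n, (w k.succ - w 0) ⬝ᵥ (w k.succ - w 0) = 1 :=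
    fun k => hw _ _ (Fin.succ_ne_zero k)
  change (w i.succ - w 0) ⬝ᵥ (w j.succ - w 0) = (1 / 2 : ℝ) * ((1 : Matrix _ _ ℝ) i j + 1)
  by_cases hij : i = j
  · subst hij
    rw [hnorm, one_apply_eq]
    norm_num
  · have h := hw i.succ j.succ (by simpa using hij)
    rw [← sub_sub_sub_cancel_right _ _ (w 0), sub_dotProduct, dotProduct_sub _ (w i.succ - w 0),
      dotProduct_sub _ (w i.succ - w 0), hnorm, hnorm, dotProduct_comm (w j.succ - w 0)] at h
    rw [one_apply_ne hij]
    linarith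

theorem one_add_ones_mul (n : ℕ) :
    (1 + of fun _ _ => 1 : Matrix (Fin n) (Fin n) ℝ) * (((n : ℝ) + 1) • 1 - of fun _ _ => 1) =
      ((n : ℝ) + 1) • 1 := by
  have hJ : (of fun _ _ => 1 : Matrix (Fin n) (Fin n) ℝ) * (of fun _ _ => 1) =
      (n : ℝ) • of fun _ _ => 1 := by
    ext i j
    simp [mul_apply]
  rw [add_mul, mul_sub, mul_sub, hJ, one_mul, one_mul, Matrix.mul_smul, mul_one]
  module

/-- For `n+1` points `w₀,…,w_n ∈ ℝⁿ` with pairwise Euclidean distance 1,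
the sum of the outer products of the edge vectors is `((n+1)/2)·Iₙ`. -/
theorem stmt_3 (n : ℕ) (hn : 1 ≤ n) (w : Fin (n + 1) → Fin n → ℝ)
    (hw : ∀ i j, i ≠ j → (w i - w j) ⬝ᵥ (w i - w j) = 1) :
    ∑ i, ∑ j ∈ Finset.univ.filter (fun j => i < j),
        vecMulVec (w i - w j) (w i - w j) =
      (((n : ℝ) + 1) / 2) • (1 : Matrix (Fin n) (Fin n) ℝ) := by
  set A : Matrix (Fin n) (Fin n) ℝ := of fun k => w k.succ - w 0 with hA
  set L : Matrix (Fin n) (Fin n) ℝ := ((n : ℝ) + 1) • 1 - of fun _ _ => 1 with hL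
  have hn0 : (n : ℝ) + 1 ≠ 0 := by positivity
  have hright : A * ((2 / ((n : ℝ) + 1)) • (Aᵀ * L)) = 1 := by
    rw [Matrix.mul_smul, ← Matrix.mul_assoc, gram_edges_of_unit_simplex w hw, Matrix.smul_mul,
      one_add_ones_mul, smul_smul, smul_smul]
    field_simp
    simp
  have hleft : Aᵀ * L * A = (((n : ℝ) + 1) / 2) • 1 := by
    have h := mul_eq_one_comm.mp hright
    rw [Matrix.smul_mul] at h
    rw [← h, smul_smul]
    field_simp
    simp
  rw [← hleft]
  have hsum := two_nsmul_sum_sum_filter_lt (fun i j => vecMulVec (w i - w j) (w i - w j))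
    (fun i j => by rw [← neg_sub (w j), neg_vecMulVec, vecMulVec_neg, neg_neg]) (by simp)
  ext a b
  have hab := congrFun (congrFun hsum a) b
  have hquad := sum_sum_sub_mul_sub (fun i => w i a - w 0 a) (fun i => w i b - w 0 b)
  have hprod : (Aᵀ * L * A) a b = ((n : ℝ) + 1) * ∑ k, A k a * A k b -
      (∑ k, A k a) * ∑ k, A k b := by
    rw [hL, Matrix.mul_sub, Matrix.sub_mul, Matrix.mul_smul, Matrix.smul_mul, Matrix.mul_one]
    simp [mul_apply, Finset.mul_sum]
  simp only [sub_sub_sub_cancel_right, Fin.sum_univ_succ (n := n) (fun i => (w i a - w 0 a) * _),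
    Fin.sum_univ_succ (n := n) (fun i => w i _ - w 0 _), sub_self, zero_mul, zero_add,
    Fintype.card_fin, Nat.cast_add, Nat.cast_one] at hquad
  rw [Matrix.smul_apply, nsmul_eq_mul, Nat.cast_ofNat] at hab
  simp only [Matrix.sum_apply, vecMulVec_apply, Pi.sub_apply] at hab
  rw [hprod]
  simp only [hA, of_apply, Pi.sub_apply, Matrix.sum_apply, vecMulVec_apply]
  linarith
end

section
/- Let J be a real n×n matrix, x ∈ ℝⁿ, let w₀,…,w_n ∈ ℝⁿ have pairwise Euclidean distance 1, and set vᵢ := J wᵢ + x. Then for every symmetric real n×n matrix M, the edge vectors eᵢⱼ = vᵢ − vⱼ satisfy Σ_{0 ≤ i < j ≤ n} eᵢⱼᵀ M eᵢⱼ = ((n+1)/2) · trace(Jᵀ M J). In particular, if M is a constant metric, the sum of the squared M-lengths of the edges of the simplex with vertices vᵢ equals ((n+1)/2) · trace(Jᵀ M J). -/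
open Matrix

/-- The sum of a symmetric function vanishing on the diagonal over all ordered pairs is twice its
sum over the pairs `i < j`. -/
theorem two_mul_sum_lt_eq_sum {ι : Type*} [Fintype ι] [LinearOrder ι] (f : ι → ι → ℝ)
    (hsymm : ∀ i j, f i j = f j i) (hdiag : ∀ i, f i i = 0) :
    2 * ∑ i, ∑ j ∈ Finset.univ.filter (fun j => i < j), f i j = ∑ i, ∑ j, f i j := by
  have hsplit : ∀ i j, f i j = (if i < j then f i j else 0) + (if j < i then f j i else 0) := by
    intro i j
    rcases lt_trichotomy i j with h | h | h
    · simp [h, h.not_gt]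
    · simp [h, hdiag]
    · simp [h, h.not_gt, hsymm i j]
  simp_rw [Finset.sum_filter]
  conv_rhs => enter [2, i, 2, j]; rw [hsplit i j]
  simp_rw [Finset.sum_add_distrib]
  rw [Finset.sum_comm (f := fun i j => if j < i then f j i else 0), two_mul]

/-- For vectors with zero sum, the sum of a quadratic form over all pairwise differences. -/
theorem sum_sum_quadForm_sub {m n : Type*} [Fintype m] [Fintype n] (N : Matrix n n ℝ)
    (b : m → n → ℝ) (hb : ∑ i, b i = 0) :
    ∑ i, ∑ j, (b i - b j) ⬝ᵥ (N *ᵥ (b i - b j)) =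
      2 * Fintype.card m * ∑ i, b i ⬝ᵥ (N *ᵥ b i) := by
  have hcross : ∀ u : n → ℝ, ∑ j, u ⬝ᵥ (N *ᵥ b j) = 0 := fun u => by
    rw [← dotProduct_sum, ← mulVec_sum, hb, mulVec_zero, dotProduct_zero]
  have hcross' : ∀ u : n → ℝ, ∑ j, b j ⬝ᵥ u = 0 := fun u => by
    rw [← sum_dotProduct, hb, zero_dotProduct]
  simp only [mulVec_sub, dotProduct_sub, sub_dotProduct, Finset.sum_sub_distrib, hcross, hcross',
    Finset.sum_const, Finset.card_univ, nsmul_eq_mul, ← Finset.mul_sum]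
  ring

/-- The Gram matrix of the vertices of a unit regular simplex centred at the origin. -/
theorem dotProduct_of_centered_unit_simplex {n : ℕ} {k : Type*} [Fintype k]
    (b : Fin (n + 1) → k → ℝ) (hb : ∑ i, b i = 0)
    (hdist : ∀ i j, i ≠ j → (b i - b j) ⬝ᵥ (b i - b j) = 1) (i j : Fin (n + 1)) :
    b i ⬝ᵥ b j = ((if i = j then 1 else 0) - ((n : ℝ) + 1)⁻¹) / 2 := by
  have hn : (n : ℝ) + 1 ≠ 0 := by positivity
  have hgram : ∀ i j, b i ⬝ᵥ b i + b j ⬝ᵥ b j - 2 * (b i ⬝ᵥ b j) =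
      1 - (if i = j then 1 else 0) := by
    intro i j
    by_cases h : i = j
    · subst h; simp; ring
    · have h1 := hdist i j h
      simp only [dotProduct_sub, sub_dotProduct, dotProduct_comm (b j) (b i)] at h1
      simp only [h, if_false]
      linarith
  have hrow : ∀ i, ((n : ℝ) + 1) * (b i ⬝ᵥ b i) + ∑ j, b j ⬝ᵥ b j = n := by
    intro i
    have h := Finset.sum_congr rfl fun j (_ : j ∈ Finset.univ) => hgram i j
    simpa [Finset.sum_add_distrib, Finset.sum_sub_distrib, ← Finset.mul_sum, ← dotProduct_sum,
      hb] using h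
  have htotal : ∑ j, b j ⬝ᵥ b j = n / 2 := by
    have h := Finset.sum_congr rfl fun i (_ : i ∈ Finset.univ) => hrow i
    simp only [Finset.sum_add_distrib, ← Finset.mul_sum, Finset.sum_const, Finset.card_univ,
      Fintype.card_fin, nsmul_eq_mul, Nat.cast_add, Nat.cast_one] at h
    apply mul_left_cancel₀ hn
    linarith
  have hnorm : ∀ i, b i ⬝ᵥ b i = (1 - ((n : ℝ) + 1)⁻¹) / 2 := by
    intro i
    have h := hrow i
    rw [htotal] at h
    field_simp
    linarith
  have h := hgram i j
  rw [hnorm, hnorm] at h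
  linarith

/-- The vertices of a centred unit regular simplex form a tight frame. -/
theorem transpose_mul_self_of_centered_unit_simplex {n : ℕ} (B : Matrix (Fin (n + 1)) (Fin n) ℝ)
    (hB : ∑ i, B i = 0) (hdist : ∀ i j, i ≠ j → (B i - B j) ⬝ᵥ (B i - B j) = 1) :
    Bᵀ * B = (1 / 2 : ℝ) • (1 : Matrix (Fin n) (Fin n) ℝ) := by
  let P : Matrix (Fin (n + 1)) (Fin (n + 1)) ℝ := of fun i => Fin.cons ((n : ℝ) + 1)⁻¹ (2 * B i)
  let Q : Matrix (Fin (n + 1)) (Fin (n + 1)) ℝ := of fun i => Fin.cons 1 (B i)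
  have hPQ : P * Qᵀ = 1 := by
    ext i j
    have h := dotProduct_of_centered_unit_simplex B hB hdist i j
    simp only [dotProduct] at h
    simp only [mul_apply, transpose_apply, P, Q, of_apply, Fin.sum_univ_succ, Fin.cons_zero,
      Fin.cons_succ, Pi.mul_apply, Pi.ofNat_apply, mul_assoc, ← Finset.mul_sum, h, one_apply]
    ring
  have hQP : Qᵀ * P = 1 := mul_eq_one_comm.mp hPQ
  ext k l
  have h := congr_fun (congr_fun hQP k.succ) l.succ
  simp only [mul_apply, transpose_apply, P, Q, of_apply, Fin.cons_succ, Pi.mul_apply,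
    Pi.ofNat_apply, one_apply, Fin.succ_inj, mul_left_comm _ (2 : ℝ), ← Finset.mul_sum] at h
  simp only [mul_apply, transpose_apply, Matrix.smul_apply, one_apply, smul_eq_mul]
  linarith

/-- For the affine image `vᵢ = J wᵢ + x` of the unit regular simplex and any
symmetric matrix `M`, the edges satisfy `Σ_{i<j} eᵢⱼᵀ M eᵢⱼ = ((n+1)/2)·trace(Jᵀ M J)`;
for a constant metric `M`, this is the sum of squared `M`-lengths of the edges. -/
theorem stmt_5 (n : ℕ) (J : Matrix (Fin n) (Fin n) ℝ) (x : Fin n → ℝ)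
    (w : Fin (n + 1) → Fin n → ℝ)
    (hw : ∀ i j, i ≠ j → (w i - w j) ⬝ᵥ (w i - w j) = 1)
    (v : Fin (n + 1) → Fin n → ℝ) (hv : ∀ i, v i = J *ᵥ w i + x)
    (M : Matrix (Fin n) (Fin n) ℝ) (hM : M.IsSymm) :
    ∑ i, ∑ j ∈ Finset.univ.filter (fun j => i < j),
        (v i - v j) ⬝ᵥ (M *ᵥ (v i - v j)) =
      (((n : ℝ) + 1) / 2) * Matrix.trace (Jᵀ * M * J) := by
  let c : Fin n → ℝ := ((n : ℝ) + 1)⁻¹ • ∑ i, w i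
  let B : Matrix (Fin (n + 1)) (Fin n) ℝ := fun i => w i - c
  have hn : (n : ℝ) + 1 ≠ 0 := by positivity
  have hsub : ∀ i j, B i - B j = w i - w j := fun i j => sub_sub_sub_cancel_right _ _ _
  have hB : ∑ i, B i = 0 := by
    ext k
    simp [B, c, hn]
  have htight := transpose_mul_self_of_centered_unit_simplex B hB
    fun i j h => by rw [hsub]; exact hw i j h
  have hquad : ∀ i j, (v i - v j) ⬝ᵥ (M *ᵥ (v i - v j)) =
      (B i - B j) ⬝ᵥ ((Jᵀ * M * J) *ᵥ (B i - B j)) := by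
    intro i j
    rw [hsub, hv, hv, add_sub_add_right_eq_sub, ← mulVec_sub, ← mulVec_mulVec, ← mulVec_mulVec,
      dotProduct_mulVec (w i - w j), vecMul_transpose]
  have htrace : ∑ i, B i ⬝ᵥ ((Jᵀ * M * J) *ᵥ B i) = trace (Jᵀ * M * J) / 2 := by
    calc ∑ i, B i ⬝ᵥ ((Jᵀ * M * J) *ᵥ B i) = trace (B * ((Jᵀ * M * J) * Bᵀ)) := rfl
      _ = trace ((Jᵀ * M * J) * (Bᵀ * B)) := by rw [trace_mul_comm, Matrix.mul_assoc]
      _ = trace (Jᵀ * M * J) / 2 := by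
        rw [htight, Matrix.mul_smul, Matrix.mul_one, trace_smul, smul_eq_mul]
        ring
  have hpairs := two_mul_sum_lt_eq_sum
    (fun i j => (B i - B j) ⬝ᵥ ((Jᵀ * M * J) *ᵥ (B i - B j)))
    (fun i j => by rw [← neg_sub (B j), mulVec_neg, neg_dotProduct_neg]) (fun i => by simp)
  rw [sum_sum_quadForm_sub _ _ hB, htrace, Fintype.card_fin] at hpairs
  simp_rw [hquad]
  push_cast at hpairs
  linarith
end

section
/- Let M : ℝ² → ℝ^{2×2} be a continuous field of symmetric positive-semidefinite matrices, let J_Δ be the (constant, invertible) Jacobian matrix of the affine map sending the reference triangle with vertices ξ₀=(0,0), ξ₁=(1,0), ξ₂=(0,1) onto the unit equilateral triangle, and let F : ℝ² → ℝ² be continuously differentiable with J_F(ξ)ᵀ M(F(ξ)) J_F(ξ) = J_Δᵀ J_Δ for all ξ in the reference triangle. Then for each pair of reference vertices ξᵢ, ξⱼ (i ≠ j), the image curve γᵢⱼ(t) = F(ξᵢ + t(ξⱼ − ξᵢ)), t ∈ [0,1], has M-length ℓ_M(γᵢⱼ) = ‖J_Δ(ξⱼ − ξᵢ)‖ = 1;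 i.e., every edge of the curved simplex F(K̂) has unit length with respect to M. -/
open Matrix

/-- Pulling a bilinear form back along a matrix. -/
theorem mulVec_dotProduct_mulVec_mulVec {m n R : Type*} [Fintype m] [Fintype n] [CommSemiring R]
    (A : Matrix m n R) (B : Matrix m m R) (u v : n → R) :
    (A *ᵥ u) ⬝ᵥ (B *ᵥ (A *ᵥ v)) = u ⬝ᵥ ((Aᵀ * B * A) *ᵥ v) := by
  rw [dotProduct_comm, dotProduct_mulVec, ← mulVec_transpose, dotProduct_comm, mulVec_mulVec,
    mulVec_mulVec, Matrix.mul_assoc]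

/-- The derivative of a differentiable map along an affine line. -/
theorem deriv_comp_add_smul {E G : Type*} [NormedAddCommGroup E] [NormedSpace ℝ E]
    [NormedAddCommGroup G] [NormedSpace ℝ G] {F : E → G} {x v : E} {t : ℝ}
    (hF : DifferentiableAt ℝ F (x + t • v)) :
    deriv (fun s : ℝ => F (x + s • v)) t = fderiv ℝ F (x + t • v) v := by
  have hline : HasDerivAt (fun s : ℝ => x + s • v) v t := by
    simpa using ((hasDerivAt_id t).smul_const v).const_add x
  exact (hF.hasFDerivAt.comp_hasDerivAt t hline).deriv

/-- Let `J_Δ` be the Jacobian of the affine map sending the reference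
triangle (vertices `(0,0), (1,0), (0,1)`) onto the unit equilateral triangle, and let `F`
be `C¹` with `J_F(ξ)ᵀ M(F(ξ)) J_F(ξ) = J_Δᵀ J_Δ` on the reference triangle. Then for each
pair of reference vertices `ξᵢ ≠ ξⱼ`, the image curve `t ↦ F(ξᵢ + t(ξⱼ − ξᵢ))` has
`M`-length `‖J_Δ(ξⱼ − ξᵢ)‖ = 1`: every edge of the curved simplex `F(K̂)` is unit in `M`. -/
theorem stmt_13 (M : (Fin 2 → ℝ) → Matrix (Fin 2) (Fin 2) ℝ)
    (hMc : Continuous M) (hMpsd : ∀ x, (M x).PosSemidef)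
    (Khat : Set (Fin 2 → ℝ))
    (hKhat : Khat = {ξ : Fin 2 → ℝ | 0 ≤ ξ 0 ∧ 0 ≤ ξ 1 ∧ ξ 0 + ξ 1 ≤ 1})
    (JΔ : Matrix (Fin 2) (Fin 2) ℝ)
    (hJΔ : JΔ = !![1, 1 / 2; 0, Real.sqrt 3 / 2])
    (F : (Fin 2 → ℝ) → Fin 2 → ℝ) (hF : ContDiff ℝ 1 F)
    (J : (Fin 2 → ℝ) → Matrix (Fin 2) (Fin 2) ℝ)
    (hJ : ∀ ξ u, J ξ *ᵥ u = fderiv ℝ F ξ u)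
    (hpull : ∀ ξ ∈ Khat, (J ξ)ᵀ * M (F ξ) * J ξ = JΔᵀ * JΔ)
    (ξv : Fin 3 → Fin 2 → ℝ)
    (hξ0 : ξv 0 = ![0, 0]) (hξ1 : ξv 1 = ![1, 0]) (hξ2 : ξv 2 = ![0, 1]) :
    ∀ i j : Fin 3, i ≠ j →
      (∫ t in (0 : ℝ)..1,
          Real.sqrt (deriv (fun s : ℝ => F (ξv i + s • (ξv j - ξv i))) t ⬝ᵥ
            (M (F (ξv i + t • (ξv j - ξv i))) *ᵥ
              deriv (fun s : ℝ => F (ξv i + s • (ξv j - ξv i))) t))) =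
          Real.sqrt ((JΔ *ᵥ (ξv j - ξv i)) ⬝ᵥ (JΔ *ᵥ (ξv j - ξv i))) ∧
      Real.sqrt ((JΔ *ᵥ (ξv j - ξv i)) ⬝ᵥ (JΔ *ᵥ (ξv j - ξv i))) = 1 := by
  intro i j hij
  refine ⟨?_, ?_⟩
  · have hseg : ∀ t ∈ Set.uIcc (0 : ℝ) 1, ξv i + t • (ξv j - ξv i) ∈ Khat := by
      intro t ht
      rw [Set.uIcc_of_le zero_le_one] at ht
      obtain ⟨h0, h1⟩ := ht
      subst hKhat
      fin_cases i <;> fin_cases j <;> simp [hξ0, hξ1, hξ2, h0, h1]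
    rw [intervalIntegral.integral_congr (g := fun _ =>
      √((JΔ *ᵥ (ξv j - ξv i)) ⬝ᵥ (JΔ *ᵥ (ξv j - ξv i))))]
    · simp
    · intro t ht
      simp only
      rw [deriv_comp_add_smul (hF.differentiable one_ne_zero _), ← hJ,
        mulVec_dotProduct_mulVec_mulVec, hpull _ (hseg t ht)]
      simpa using congrArg Real.sqrt
        (mulVec_dotProduct_mulVec_mulVec JΔ 1 (ξv j - ξv i) (ξv j - ξv i)).symm
  · have h3 : √3 * √3 = (3 : ℝ) := Real.mul_self_sqrt (by norm_num)
    rw [Real.sqrt_eq_one, hJΔ]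
    fin_cases i <;> fin_cases j <;>
      first
      | exact absurd rfl hij
      | (simp [hξ0, hξ1, hξ2, Matrix.mulVec, dotProduct, Fin.sum_univ_two]; try linarith)
end

section
/- Let M be a symmetric positive-definite real 2×2 matrix, let w₀ = (0,0), w₁ = (1,0), w₂ = (1/2, √3/2), let J be a real 2×2 matrix with det J > 0, x ∈ ℝ², and set vᵢ = J wᵢ + x with edges eᵢⱼ = vᵢ − vⱼ. Define the distortion-based quality Q := ( (1/2)·trace(JᵀMJ) / √(det(JᵀMJ)) )^{-1} and the M-area |K|_M := √(det M) · det J · (√3/4). Then Q = (12/√3) · |K|_M / Σ_{0≤i<j≤2} eᵢⱼᵀ M eᵢⱼ, and Q ≤ 1 with equality if and only if JᵀMJ = c·I₂ for some c > 0. -/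
open Matrix

/-- The squared `M`-length of an image vector is the squared length in the pulled-back metric. -/
lemma dotProduct_mulVec_mulVec_mulVec {m n R : Type*} [Fintype m] [Fintype n] [CommRing R]
    (M : Matrix m m R) (J : Matrix m n R) (u : n → R) :
    (J *ᵥ u) ⬝ᵥ (M *ᵥ (J *ᵥ u)) = u ⬝ᵥ ((Jᵀ * M * J) *ᵥ u) := by
  rw [← Matrix.mulVec_mulVec, ← Matrix.mulVec_mulVec, Matrix.dotProduct_mulVec u,
    Matrix.vecMul_transpose]

/-- The squared edge lengths of the unit equilateral triangle, measured in the bilinear form `A`,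
add up to `3 / 2 * trace A`. -/
lemma sum_edges_equilateral (A : Matrix (Fin 2) (Fin 2) ℝ) (w : Fin 3 → Fin 2 → ℝ)
    (hw0 : w 0 = ![0, 0]) (hw1 : w 1 = ![1, 0])
    (hw2 : w 2 = ![1 / 2, Real.sqrt 3 / 2]) :
    ∑ i, ∑ j ∈ Finset.univ.filter (fun j => i < j), (w i - w j) ⬝ᵥ (A *ᵥ (w i - w j)) =
      3 / 2 * A.trace := by
  have h3 : Real.sqrt 3 ^ 2 = 3 := Real.sq_sqrt (by norm_num)
  simp only [Finset.sum_filter, Fin.sum_univ_three, hw0, hw1, hw2]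
  simp [Matrix.mulVec, dotProduct, Fin.sum_univ_two, Matrix.trace]
  linear_combination (A 1 1 / 2) * h3

/-- In dimension two, `trace² - 4 det` of a symmetric matrix is a sum of squares. -/
lemma trace_sq_sub_four_mul_det {R : Type*} [CommRing R] {A : Matrix (Fin 2) (Fin 2) R}
    (hA : A.IsSymm) :
    A.trace ^ 2 - 4 * A.det = (A 0 0 - A 1 1) ^ 2 + (2 * A 0 1) ^ 2 := by
  rw [Matrix.trace_fin_two, Matrix.det_fin_two, hA.apply 0 1]
  ring

/-- The arithmetic-geometric mean inequality for the eigenvalues of a `2 × 2` positive-definite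
matrix. -/
lemma two_mul_sqrt_det_le_trace {A : Matrix (Fin 2) (Fin 2) ℝ} (hA : A.PosDef) :
    2 * Real.sqrt A.det ≤ A.trace := by
  have hsymm : A.IsSymm := (Matrix.conjTranspose_eq_transpose_of_trivial A).symm.trans hA.1
  have hs := Real.sq_sqrt hA.det_pos.le
  refine le_of_sq_le_sq ?_ hA.trace_pos.le
  nlinarith [trace_sq_sub_four_mul_det hsymm, sq_nonneg (A 0 0 - A 1 1), sq_nonneg (2 * A 0 1)]

/-- Equality in `two_mul_sqrt_det_le_trace` characterizes positive multiples of the identity. -/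
lemma two_mul_sqrt_det_eq_trace_iff {A : Matrix (Fin 2) (Fin 2) ℝ} (hA : A.PosDef) :
    2 * Real.sqrt A.det = A.trace ↔
      ∃ c : ℝ, 0 < c ∧ A = c • (1 : Matrix (Fin 2) (Fin 2) ℝ) := by
  constructor
  · intro h
    have hsymm : A.IsSymm := (Matrix.conjTranspose_eq_transpose_of_trivial A).symm.trans hA.1
    have hs := Real.sq_sqrt hA.det_pos.le
    have hsum : (A 0 0 - A 1 1) ^ 2 + (2 * A 0 1) ^ 2 = 0 := by
      rw [← trace_sq_sub_four_mul_det hsymm, ← h, mul_pow, hs]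
      ring
    have hdiag : A 0 0 = A 1 1 := by
      nlinarith [sq_nonneg (A 0 0 - A 1 1), sq_nonneg (2 * A 0 1)]
    have hoff : A 0 1 = 0 := by
      nlinarith [sq_nonneg (A 0 0 - A 1 1), sq_nonneg (2 * A 0 1)]
    refine ⟨A 0 0, hA.diag_pos, ?_⟩
    ext i j
    fin_cases i <;> fin_cases j <;> simp [hoff, hdiag, hsymm.apply 0 1]
  · rintro ⟨c, hc, rfl⟩
    rw [Matrix.det_smul, Matrix.trace_smul, Matrix.det_one, Matrix.trace_one, mul_one,
      Fintype.card_fin, Real.sqrt_sq hc.le, smul_eq_mul]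
    push_cast
    ring

/-- For the affine image `vᵢ = J wᵢ + x` (with `det J > 0`) of the unit
equilateral triangle `w₀ = (0,0)`, `w₁ = (1,0)`, `w₂ = (1/2, √3/2)` and a symmetric
positive-definite metric `M`, the distortion-based quality
`Q = ((1/2)·trace(JᵀMJ)/√(det(JᵀMJ)))⁻¹` satisfies
`Q = (12/√3)·|K|_M / Σ_{i<j} eᵢⱼᵀ M eᵢⱼ` with `|K|_M = √(det M)·det J·(√3/4)`, and
`Q ≤ 1` with equality iff `JᵀMJ = c·I` for some `c > 0`. -/
theorem stmt_15 (M : Matrix (Fin 2) (Fin 2) ℝ) (hM : M.PosDef)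
    (w : Fin 3 → Fin 2 → ℝ)
    (hw0 : w 0 = ![0, 0]) (hw1 : w 1 = ![1, 0])
    (hw2 : w 2 = ![1 / 2, Real.sqrt 3 / 2])
    (J : Matrix (Fin 2) (Fin 2) ℝ) (hJ : 0 < J.det) (x : Fin 2 → ℝ)
    (v : Fin 3 → Fin 2 → ℝ) (hv : ∀ i, v i = J *ᵥ w i + x)
    (Q areaM : ℝ)
    (hQ : Q = ((1 / 2) * Matrix.trace (Jᵀ * M * J) / Real.sqrt (Jᵀ * M * J).det)⁻¹)
    (hA : areaM = Real.sqrt M.det * J.det * (Real.sqrt 3 / 4)) :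
    Q = (12 / Real.sqrt 3) * areaM /
        (∑ i, ∑ j ∈ Finset.univ.filter (fun j => i < j),
          (v i - v j) ⬝ᵥ (M *ᵥ (v i - v j))) ∧
      Q ≤ 1 ∧
      (Q = 1 ↔ ∃ c : ℝ, 0 < c ∧ Jᵀ * M * J = c • (1 : Matrix (Fin 2) (Fin 2) ℝ)) := by
  have hApos : (Jᵀ * M * J).PosDef := by
    rw [← Matrix.conjTranspose_eq_transpose_of_trivial J]
    exact hM.conjTranspose_mul_mul_same
      (Matrix.mulVec_injective_of_det_ne_zero hJ.ne')
  have hsum : (∑ i, ∑ j ∈ Finset.univ.filter (fun j => i < j),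
      (v i - v j) ⬝ᵥ (M *ᵥ (v i - v j))) = 3 / 2 * (Jᵀ * M * J).trace := by
    rw [← sum_edges_equilateral _ w hw0 hw1 hw2]
    refine Finset.sum_congr rfl fun i _ => Finset.sum_congr rfl fun j _ => ?_
    rw [hv, hv, add_sub_add_right_eq_sub, ← Matrix.mulVec_sub, dotProduct_mulVec_mulVec_mulVec]
  have hdet : Real.sqrt (Jᵀ * M * J).det = Real.sqrt M.det * J.det := by
    rw [Matrix.det_mul, Matrix.det_mul, Matrix.det_transpose,
      show J.det * M.det * J.det = M.det * J.det ^ 2 by ring, Real.sqrt_mul hM.det_pos.le,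
      Real.sqrt_sq hJ.le]
  have htr := hApos.trace_pos
  have hQ' : Q = 2 * Real.sqrt (Jᵀ * M * J).det / (Jᵀ * M * J).trace := by
    rw [hQ, inv_div]
    field_simp
  refine ⟨?_, ?_, ?_⟩
  · have h3 : Real.sqrt 3 ≠ 0 := by positivity
    rw [hsum, hA, hQ', hdet]
    field_simp
    ring
  · rw [hQ', div_le_one htr]
    exact two_mul_sqrt_det_le_trace hApos
  · rw [hQ', div_eq_one_iff_eq htr.ne']
    exact two_mul_sqrt_det_eq_trace_iff hApos
end
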